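/- Let s₁, …, s_M ∈ {0,1}^{2n} be strings, let d₁, …, d_M ∈ {0,…,2n}, and define strings r₁ = 0^{6n}, r₂ = 1^{4n} 0^{2n}, and s'_j = s_j · 1^n · 0^n · 1^{2n−d_j} · 0^{d_j} of length 6n. If t' ∈ {0,1}^{6n} has Hamming distance at most 2n to r₁, r₂, and every s'_j, then the prefix t = t'[1…2n] satisfies d(t, s_j) ≤ d_j for all j. -/

import Mathlib

/-- An interval of values inside `Fin m` has the expected number of elements. -/
theorem card_filter_val_mem_Ico {m : ℕ} (a b : ℕ) (hb : b ≤ m) :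
    (Finset.univ.filter fun p : Fin m => a ≤ (p : ℕ) ∧ (p : ℕ) < b).card = b - a := by
  rw [← Nat.card_Ico, ← Finset.card_map Fin.valEmbedding]
  congr 1
  ext x
  simp only [Finset.mem_map, Finset.mem_filter, Finset.mem_univ, true_and, Finset.mem_Ico,
    Fin.valEmbedding_apply]
  constructor
  · rintro ⟨p, hp, rfl⟩
    exact hp
  · intro hx
    exact ⟨⟨x, by omega⟩, hx, rfl⟩

/-- If `t` differs from both `0^m` and `1^k 0^(m-k)` in few places, whose total is at most `k`,
then `t` vanishes from position `k` on. -/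
theorem eq_false_of_hammingDist_add_le {m k : ℕ} (hk : k ≤ m) (t : Fin m → Bool)
    (h : hammingDist t (fun _ => false) +
      hammingDist t (fun p => decide ((p : ℕ) < k)) ≤ k)
    (p : Fin m) (hp : k ≤ (p : ℕ)) : t p = false := by
  by_contra hne
  simp only [hammingDist] at h
  rw [← Finset.card_union_add_card_inter] at h
  have hunion := Finset.card_le_card (s := Finset.univ.filter fun q : Fin m =>
      0 ≤ (q : ℕ) ∧ (q : ℕ) < k)
    (t := (Finset.univ.filter fun q => t q ≠ false) ∪
      Finset.univ.filter fun q => t q ≠ decide ((q : ℕ) < k)) (by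
    intro q hq
    cases hq' : t q <;> simp_all)
  rw [card_filter_val_mem_Ico 0 k hk] at hunion
  have hinter : 0 < ((Finset.univ.filter fun q => t q ≠ false) ∩
      Finset.univ.filter fun q => t q ≠ decide ((q : ℕ) < k)).card :=
    Finset.card_pos.mpr ⟨p, by simp_all⟩
  omega


/-- Soundness of the Closest String reduction: if `t' ∈ {0,1}^{6n}` is within
Hamming distance `2n` of `r₁ = 0^{6n}`, `r₂ = 1^{4n}0^{2n}` and of every
padded string `s'_j = s_j · 1^n · 0^n · 1^{2n-d_j} · 0^{d_j}`, then the
prefix `t = t'[1…2n]` satisfies `d(t, s_j) ≤ d_j` for all `j`. -/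
theorem stmt_6 (n M : ℕ) (s : Fin M → Fin (2 * n) → Bool)
    (d : Fin M → ℕ) (hd : ∀ j, d j ≤ 2 * n)
    (t' : Fin (6 * n) → Bool)
    (hr1 : hammingDist t' (fun _ => false) ≤ 2 * n)
    (hr2 : hammingDist t' (fun p => decide ((p : ℕ) < 4 * n)) ≤ 2 * n)
    (hs : ∀ j, hammingDist t'
        (fun p => if h : (p : ℕ) < 2 * n then s j ⟨p, h⟩
          else if (p : ℕ) < 3 * n then true
          else if (p : ℕ) < 4 * n then false
          else if (p : ℕ) < 6 * n - d j then true
          else false) ≤ 2 * n) :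
    ∀ j, hammingDist (fun i : Fin (2 * n) =>
        t' (Fin.castLE (by omega) i)) (s j) ≤ d j := by
  intro j
  have hzero := eq_false_of_hammingDist_add_le (k := 4 * n) (by omega) t' (by omega)
  have hj := hs j
  have hdj := hd j
  unfold hammingDist at hj ⊢
  set P := Finset.univ.filter fun i : Fin (2 * n) => t' (Fin.castLE (by omega) i) ≠ s j i
  set Q := Finset.univ.filter fun p : Fin (6 * n) => 4 * n ≤ (p : ℕ) ∧ (p : ℕ) < 6 * n - d j
  have hcard : Q.card = 6 * n - d j - 4 * n := card_filter_val_mem_Ico _ _ (by omega)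
  have hdisj : Disjoint (P.map (Fin.castLEEmb (by omega))) Q := by
    rw [Finset.disjoint_left]
    intro p hp hq
    obtain ⟨i, -, rfl⟩ := Finset.mem_map.mp hp
    have hi := (Finset.mem_filter.mp hq).2.1
    have := i.isLt
    simp only [Fin.castLEEmb_apply, Fin.val_castLE] at hi
    omega
  have hle := Finset.card_le_card (Finset.union_subset (s := P.map (Fin.castLEEmb (by omega)))
    (t := Q) (u := Finset.univ.filter fun p : Fin (6 * n) => t' p ≠
      if h : (p : ℕ) < 2 * n then s j ⟨p, h⟩
      else if (p : ℕ) < 3 * n then true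
      else if (p : ℕ) < 4 * n then false
      else if (p : ℕ) < 6 * n - d j then true
      else false)
    (by
      intro p hp
      obtain ⟨i, hi, rfl⟩ := Finset.mem_map.mp hp
      simpa [P] using hi)
    (by
      intro p hp
      obtain ⟨h₁, h₂⟩ := (Finset.mem_filter.mp hp).2
      have h₃ : ¬ (p : ℕ) < 2 * n := by omega
      have h₄ : ¬ (p : ℕ) < 3 * n := by omega
      have h₅ : ¬ (p : ℕ) < 4 * n := by omega
      simp [hzero p h₁, h₂, h₃, h₄, h₅]))
  rw [Finset.card_union_of_disjoint hdisj, Finset.card_map] at hle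
  have := hle.trans hj
  omega
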